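/- Let Ω ⊂ ℝ^m be a bounded open set with smooth boundary, let k ≥ 1 be an integer and let α ∈ (0,1). Then there exists a constant C > 0 such that for every f ∈ C̃^{αk}(cl Ω) one has sup_{s>0} s^{−α} K(s, f; C̃^0(cl Ω), C̃^k(cl Ω)) ≤ C ‖f‖_{C^{αk}(cl Ω)}. In other words, the inclusion C̃^{αk}(cl Ω) ⊂ (C̃^0(cl Ω), C̃^k(cl Ω))_{α,∞} is continuous. -/

import Mathlib

open Set

noncomputable section

/-- `Ω` has smooth boundary: near every boundary point, `Ω` is the sublevel set of a smooth
function with non-vanishing differential. -/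
def HasSmoothBoundary {E : Type*} [NormedAddCommGroup E] [NormedSpace ℝ E] (Ω : Set E) : Prop :=
  ∀ x ∈ frontier Ω, ∃ (U : Set E) (φ : E → ℝ), IsOpen U ∧ x ∈ U ∧ ContDiff ℝ (⊤ : ℕ∞) φ ∧
    (∀ y ∈ U, fderiv ℝ φ y ≠ 0) ∧ Ω ∩ U = {y ∈ U | φ y < 0}

/-- `f` belongs to `C^t(s)`: it is `C^⌊t⌋` on `s`, with bounded derivatives of order `≤ ⌊t⌋`,
and the order-`⌊t⌋` derivative is `(t - ⌊t⌋)`-Hölder continuous on `s`. -/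
def MemCt {E : Type*} [NormedAddCommGroup E] [NormedSpace ℝ E]
    (t : ℝ) (s : Set E) (f : E → ℝ) : Prop :=
  ContDiffOn ℝ (⌊t⌋₊ : ℕ) f s ∧
  (∃ C : ℝ, ∀ i : ℕ, (i : ℝ) ≤ t → ∀ x ∈ s, ‖iteratedFDerivWithin ℝ i f s x‖ ≤ C) ∧
  (∃ C : ℝ, ∀ x ∈ s, ∀ y ∈ s,
    ‖iteratedFDerivWithin ℝ ⌊t⌋₊ f s x - iteratedFDerivWithin ℝ ⌊t⌋₊ f s y‖
      ≤ C * ‖x - y‖ ^ (t - (⌊t⌋₊ : ℝ)))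

/-- The `C^t` norm on a set `s`. -/
def ctNorm {E : Type*} [NormedAddCommGroup E] [NormedSpace ℝ E]
    (t : ℝ) (s : Set E) (f : E → ℝ) : ℝ :=
  max (sSup {r : ℝ | ∃ i : ℕ, (i : ℝ) ≤ t ∧ ∃ x ∈ s, r = ‖iteratedFDerivWithin ℝ i f s x‖})
      (sSup {r : ℝ | ∃ x ∈ s, ∃ y ∈ s, x ≠ y ∧
        r = ‖iteratedFDerivWithin ℝ ⌊t⌋₊ f s x - iteratedFDerivWithin ℝ ⌊t⌋₊ f s y‖
              / ‖x - y‖ ^ (t - (⌊t⌋₊ : ℝ))})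

/-- `f ∈ C̃^t(cl Ω)`: `f ∈ C^t(cl Ω)` and `f` vanishes on `∂Ω`. -/
def MemCtTilde {E : Type*} [NormedAddCommGroup E] [NormedSpace ℝ E]
    (t : ℝ) (Ω : Set E) (f : E → ℝ) : Prop :=
  MemCt t (closure Ω) f ∧ ∀ x ∈ frontier Ω, f x = 0

/-- The K-functional `K(s, f; C̃^{t₀}(cl Ω), C̃^{t₁}(cl Ω))`. -/
def kFunctional {E : Type*} [NormedAddCommGroup E] [NormedSpace ℝ E]
    (s : ℝ) (t₀ t₁ : ℝ) (Ω : Set E) (f : E → ℝ) : ℝ :=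
  sInf {r : ℝ | ∃ f₀ f₁ : E → ℝ, (∀ x ∈ closure Ω, f x = f₀ x + f₁ x) ∧
    MemCtTilde t₀ Ω f₀ ∧ MemCtTilde t₁ Ω f₁ ∧
    r = ctNorm t₀ (closure Ω) f₀ + s * ctNorm t₁ (closure Ω) f₁}

open MeasureTheory Metric Topology

section Convolution

open scoped Convolution

variable {E F : Type*} [NormedAddCommGroup E] [NormedSpace ℝ E]

universe u in
/-- Derivatives of a convolution with a smooth compactly supported kernel fall on the kernel. -/
theorem norm_iteratedFDeriv_convolution_right_le {E F F' G : Type u}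
    [NormedAddCommGroup E] [NormedSpace ℝ E] [FiniteDimensional ℝ E]
    [MeasurableSpace E] [BorelSpace E]
    [NormedAddCommGroup F] [NormedSpace ℝ F] [NormedAddCommGroup F'] [NormedSpace ℝ F']
    [NormedAddCommGroup G] [NormedSpace ℝ G] {μ : Measure E} [μ.IsAddHaarMeasure]
    {f : E → F} (hf : LocallyIntegrable f μ) (L : F →L[ℝ] F' →L[ℝ] G) {g : E → F'}
    (hg : ContDiff ℝ (⊤ : ℕ∞) g) (hgc : HasCompactSupport g) (x : E) (i : ℕ) :
    ‖iteratedFDeriv ℝ i (f ⋆[L, μ] g) x‖ ≤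
      ‖L‖ * ∫ u, ‖f (x - u)‖ * ‖iteratedFDeriv ℝ i g u‖ ∂μ := by
  induction i generalizing F' G with
  | zero =>
    simp only [norm_iteratedFDeriv_zero]
    rw [convolution_eq_swap, ← integral_const_mul]
    refine norm_integral_le_of_norm_le (Integrable.const_mul ?_ _)
      (Filter.Eventually.of_forall fun u => ?_)
    · have h := (hgc.norm.convolutionExists_right (ContinuousLinearMap.mul ℝ ℝ)
        (fun y => (hf y).norm)
        hg.continuous.norm x).integrable_swap
      simpa using h
    · rw [← mul_assoc]
      exact L.le_opNorm₂ _ _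
  | succ i ih =>
    have hfd : fderiv ℝ (f ⋆[L, μ] g) = f ⋆[L.precompR E, μ] (fderiv ℝ g) := by
      funext y
      exact (hgc.hasFDerivAt_convolution_right L hf (hg.of_le (by exact_mod_cast le_top)) y).fderiv
    rw [← norm_iteratedFDeriv_fderiv, hfd]
    refine (ih (L.precompR E) (hg.fderiv_right (by simp)) (hgc.fderiv (𝕜 := ℝ))).trans ?_
    simp only [norm_iteratedFDeriv_fderiv]
    gcongr
    exact ContinuousLinearMap.norm_precompR_le E L

theorem norm_iteratedFDeriv_comp_const_smul_le [NormedAddCommGroup F] [NormedSpace ℝ F]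
    {g : E → F} {i : ℕ} (hg : ContDiff ℝ i g) (c : ℝ) (x : E) :
    ‖iteratedFDeriv ℝ i (fun y => g (c • y)) x‖ ≤ |c| ^ i * ‖iteratedFDeriv ℝ i g (c • x)‖ := by
  have h := (c • ContinuousLinearMap.id ℝ E).iteratedFDeriv_comp_right hg x le_rfl
  have h2 : (g ∘ (c • ContinuousLinearMap.id ℝ E)) = fun y => g (c • y) := rfl
  rw [h2] at h
  rw [h]
  refine (ContinuousMultilinearMap.norm_compContinuousLinearMap_le _ _).trans ?_
  rw [mul_comm]
  have h3 : ‖c • ContinuousLinearMap.id ℝ E‖ ≤ |c| := by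
    rw [norm_smul, Real.norm_eq_abs]
    exact mul_le_of_le_one_right (abs_nonneg _) ContinuousLinearMap.norm_id_le
  simp only [Finset.prod_const, Finset.card_univ, Fintype.card_fin]
  gcongr
  simp

end Convolution

/-- Taylor estimate on `[0, 1]` for a chain of successive derivatives whose last member
oscillates by at most `K`. -/
theorem abs_sub_taylor_sum_le {n : ℕ} {F : ℕ → ℝ → ℝ} {K : ℝ}
    (hF : ∀ j < n, ∀ τ ∈ Icc (0 : ℝ) 1, HasDerivWithinAt (F j) (F (j + 1) τ) (Icc 0 1) τ)
    (hK : ∀ τ ∈ Icc (0 : ℝ) 1, |F n τ - F n 0| ≤ K) {τ : ℝ} (hτ : τ ∈ Icc (0 : ℝ) 1) :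
    |F 0 τ - ∑ j ∈ Finset.range (n + 1), F j 0 * τ ^ j / (j.factorial : ℝ)| ≤ K := by
  induction n generalizing F τ with
  | zero => simpa using hK τ hτ
  | succ n ih =>
    have ih' := fun σ (hσ : σ ∈ Icc (0 : ℝ) 1) => ih (F := fun j => F (j + 1))
      (fun j hj => hF (j + 1) (by omega)) hK hσ
    have hK0 : 0 ≤ K := (abs_nonneg _).trans (hK 0 (by simp))
    set R : ℝ → ℝ := fun σ =>
      F 0 σ - ∑ j ∈ Finset.range (n + 1 + 1), F j 0 * σ ^ j / (j.factorial : ℝ) with hR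
    have hder : ∀ σ ∈ Icc (0 : ℝ) 1, HasDerivWithinAt R
        (F 1 σ - ∑ j ∈ Finset.range (n + 1), F (j + 1) 0 * σ ^ j / (j.factorial : ℝ))
        (Icc 0 1) σ := by
      intro σ hσ
      refine (hF 0 (by omega) σ hσ).sub ?_
      have h1 : HasDerivAt (fun σ : ℝ => ∑ j ∈ Finset.range (n + 1 + 1),
          F j 0 * σ ^ j / (j.factorial : ℝ)) (∑ j ∈ Finset.range (n + 1 + 1),
          F j 0 * (j * σ ^ (j - 1)) / (j.factorial : ℝ)) σ :=
        HasDerivAt.fun_sum fun j _ => ((hasDerivAt_pow j σ).const_mul _).div_const _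
      convert h1.hasDerivWithinAt using 1
      rw [Finset.sum_range_succ' _ (n + 1)]
      simp only [Nat.factorial_succ, Nat.cast_mul, Nat.add_sub_cancel]
      simp only [CharP.cast_eq_zero, zero_mul, mul_zero, zero_div, add_zero]
      refine Finset.sum_congr rfl fun j _ => ?_
      have h2 : ((j + 1 : ℕ) : ℝ) ≠ 0 := by positivity
      have h3 : (j.factorial : ℝ) ≠ 0 := by positivity
      field_simp
    have hR0 : R 0 = 0 := by
      simp only [hR]
      rw [Finset.sum_range_succ' _ (n + 1)]
      simp
    have := (convex_Icc (0 : ℝ) 1).norm_image_sub_le_of_norm_hasDerivWithin_le hder ih'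
      (left_mem_Icc.2 zero_le_one) hτ
    rw [hR0, sub_zero, sub_zero, Real.norm_eq_abs, Real.norm_eq_abs, abs_of_nonneg hτ.1] at this
    exact this.trans (mul_le_of_le_one_right hK0 hτ.2)

theorem exists_sum_mul_pow_eq_zero_pow (n : ℕ) :
    ∃ c : ℕ → ℝ, ∀ j ≤ n, ∑ p ∈ Finset.range (n + 1), c p * ((p : ℝ) + 1) ^ j = 0 ^ j := by
  refine ⟨fun p => -(-1) ^ (n + 1) * ((-1) ^ (n - p) * ((n + 1).choose (p + 1) : ℝ)),
    fun j hj => ?_⟩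
  have h := congrFun (fwdDiff_iter_pow_eq_zero_of_lt (R := ℝ) (Nat.lt_succ_of_le hj)) 0
  rw [fwdDiff_iter_eq_sum_shift, Finset.sum_range_succ'] at h
  simp only [zsmul_eq_mul, nsmul_eq_mul, Pi.zero_apply] at h
  push_cast at h
  simp only [zero_add, mul_one, Nat.choose_zero_right, Nat.cast_one, Nat.succ_eq_add_one] at h
  have h1 : ((-1 : ℝ) ^ (n + 1)) * (-1) ^ (n + 1) = 1 := by
    rw [← mul_pow]; norm_num
  calc ∑ p ∈ Finset.range (n + 1), -(-1 : ℝ) ^ (n + 1) *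
        ((-1) ^ (n - p) * ((n + 1).choose (p + 1) : ℝ)) * ((p : ℝ) + 1) ^ j
      = -(-1 : ℝ) ^ (n + 1) * ∑ p ∈ Finset.range (n + 1),
        (-1) ^ (n - p) * ((n + 1).choose (p + 1) : ℝ) * ((p : ℝ) + 1) ^ j := by
        rw [Finset.mul_sum]
        exact Finset.sum_congr rfl fun p _ => by ring
    _ = 0 ^ j := by
        rw [eq_neg_of_add_eq_zero_left h]
        linear_combination (0 : ℝ) ^ j * h1

/-- A smooth kernel of integral one with vanishing moments of orders `1, …, n`, supported in the
cone over a prescribed ball. -/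
theorem exists_moment_kernel {E : Type*} [NormedAddCommGroup E] [NormedSpace ℝ E]
    [FiniteDimensional ℝ E] [MeasurableSpace E] [BorelSpace E] (μ : Measure E) [μ.IsAddHaarMeasure]
    (n : ℕ) (w : E) {r : ℝ} (hr : 0 < r) :
    ∃ κ : E → ℝ, ContDiff ℝ (⊤ : ℕ∞) κ ∧ HasCompactSupport κ ∧
      (∀ u ∈ tsupport κ, ∃ τ ∈ Icc (0 : ℝ) 1, ∃ y ∈ closedBall w r, u = τ • y) ∧
      ∫ u, κ u ∂μ = 1 ∧
      ∀ j, 1 ≤ j → j ≤ n → ∀ a : E [×j]→L[ℝ] ℝ, ∫ u, κ u * a (fun _ => u) ∂μ = 0 := by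
  obtain ⟨c, hc⟩ := exists_sum_mul_pow_eq_zero_pow n
  have hn : (0 : ℝ) < n + 1 := by positivity
  let b : ContDiffBump (((n : ℝ) + 1)⁻¹ • w) :=
    ⟨((n : ℝ) + 1)⁻¹ * r / 2, ((n : ℝ) + 1)⁻¹ * r, by positivity, by
      have : 0 < ((n : ℝ) + 1)⁻¹ * r := by positivity
      linarith⟩
  set ρ : E → ℝ := b.normed μ with hρ
  have hρs : ContDiff ℝ (⊤ : ℕ∞) ρ := b.contDiff_normed
  have hρc : HasCompactSupport ρ := b.hasCompactSupport_normed
  obtain ⟨m, hm⟩ : ∃ m, m = Module.finrank ℝ E := ⟨_, rfl⟩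
  set K : Set E := (fun z : ℝ × E => z.1 • z.2) '' (Icc (0 : ℝ) 1 ×ˢ closedBall w r) with hKdef
  have hK : IsCompact K :=
    (isCompact_Icc.prod (isCompact_closedBall w r)).image (by fun_prop)
  set κ : E → ℝ := fun u => ∑ p ∈ Finset.range (n + 1),
    c p * (((p : ℝ) + 1) ^ m)⁻¹ * ρ (((p : ℝ) + 1)⁻¹ • u) with hκ
  have hsupp : Function.support κ ⊆ K := by
    intro u hu
    by_contra hcon
    refine hu (Finset.sum_eq_zero fun p hp => ?_)
    have : ρ (((p : ℝ) + 1)⁻¹ • u) = 0 := by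
      by_contra hne
      have hmem : ((p : ℝ) + 1)⁻¹ • u ∈ ball (((n : ℝ) + 1)⁻¹ • w) (((n : ℝ) + 1)⁻¹ * r) := by
        have := b.support_normed_eq (μ := μ)
        rw [← hρ] at this
        rw [show ball (((n : ℝ) + 1)⁻¹ • w) (((n : ℝ) + 1)⁻¹ * r) = Function.support ρ from
          this.symm]
        exact hne
      refine hcon ⟨⟨((p : ℝ) + 1) / (n + 1), ((n : ℝ) + 1) • ((p : ℝ) + 1)⁻¹ • u⟩,
        ⟨⟨by positivity, ?_⟩, ?_⟩, ?_⟩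
      · rw [div_le_one hn]
        have : p ≤ n := by simpa [Nat.lt_succ_iff] using hp
        gcongr
      · rw [mem_ball_iff_norm] at hmem
        rw [mem_closedBall_iff_norm]
        have h2 : ((n : ℝ) + 1) • ((p : ℝ) + 1)⁻¹ • u - w =
            ((n : ℝ) + 1) • (((p : ℝ) + 1)⁻¹ • u - ((n : ℝ) + 1)⁻¹ • w) := by
          rw [smul_sub, smul_inv_smul₀ hn.ne']
        rw [h2, norm_smul, Real.norm_of_nonneg hn.le]
        calc ((n : ℝ) + 1) * _ ≤ ((n : ℝ) + 1) * (((n : ℝ) + 1)⁻¹ * r) := by gcongr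
          _ = r := by field_simp
      · have hp1 : (p : ℝ) + 1 ≠ 0 := by positivity
        simp only [smul_smul]
        rw [show ((p : ℝ) + 1) / (n + 1) * (((n : ℝ) + 1) * ((p : ℝ) + 1)⁻¹) = 1 by field_simp,
          one_smul]
    rw [this, mul_zero]
  have hκc : HasCompactSupport κ :=
    HasCompactSupport.of_support_subset_isCompact hK hsupp
  have hmom : ∀ j ≤ n, ∀ h : E → ℝ, Continuous h → (∀ (q : ℝ) v, h (q • v) = q ^ j * h v) →
      ∫ u, κ u * h u ∂μ = 0 ^ j * ∫ v, ρ v * h v ∂μ := by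
    intro j hj h hcont hhom
    have hterm : ∀ p : ℕ, ∫ u, c p * (((p : ℝ) + 1) ^ m)⁻¹ * ρ (((p : ℝ) + 1)⁻¹ • u) * h u ∂μ
        = c p * ((p : ℝ) + 1) ^ j * ∫ v, ρ v * h v ∂μ := by
      intro p
      have hp1 : (0 : ℝ) < (p : ℝ) + 1 := by positivity
      have h1 := Measure.integral_comp_inv_smul μ (fun v => ρ v * h v) ((p : ℝ) + 1)
      have h2 : ∀ u, c p * (((p : ℝ) + 1) ^ m)⁻¹ * ρ (((p : ℝ) + 1)⁻¹ • u) * h u =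
          c p * (((p : ℝ) + 1) ^ m)⁻¹ * ((p : ℝ) + 1) ^ j *
            (ρ (((p : ℝ) + 1)⁻¹ • u) * h (((p : ℝ) + 1)⁻¹ • u)) := by
        intro u
        have : h u = ((p : ℝ) + 1) ^ j * h (((p : ℝ) + 1)⁻¹ • u) := by
          rw [← hhom, smul_inv_smul₀ hp1.ne']
        rw [this]; ring
      simp_rw [h2]
      rw [integral_const_mul, h1, ← hm, abs_of_pos (by positivity), smul_eq_mul]
      field_simp
    simp only [hκ, Finset.sum_mul]
    rw [integral_finsetSum]
    · simp_rw [hterm]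
      rw [← Finset.sum_mul, hc j hj]
    · intro p _
      have hp1 : (0 : ℝ) < (p : ℝ) + 1 := by positivity
      refine Continuous.integrable_of_hasCompactSupport ?_ ?_
      · have := hρs.continuous
        fun_prop
      · refine HasCompactSupport.mul_right (HasCompactSupport.mul_left ?_)
        exact hρc.comp_smul (inv_ne_zero hp1.ne')
  refine ⟨κ, ?_, hκc, fun u hu => ?_, ?_, fun j hj1 hjn a => ?_⟩
  · refine ContDiff.sum fun p _ => contDiff_const.mul (hρs.comp (contDiff_const_smul _))
  · obtain ⟨⟨τ, y⟩, ⟨hτ, hy⟩, rfl⟩ := closure_minimal hsupp hK.isClosed hu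
    exact ⟨τ, hτ, y, hy, rfl⟩
  · have := hmom 0 (Nat.zero_le _) (fun _ => 1) continuous_const (by simp)
    simpa [hρ, b.integral_normed] using this
  · rw [hmom j hjn (fun u => a fun _ => u) (by fun_prop) ?_, zero_pow (by omega), zero_mul]
    intro q v
    simpa using a.map_smul_univ (fun _ => q) (fun _ => v)

/-- `f` is of class `C^t` on `S`, with derivatives and Hölder seminorm bounded by `N`. -/
structure HasCtBound {E : Type*} [NormedAddCommGroup E] [NormedSpace ℝ E]
    (t : ℝ) (S : Set E) (f : E → ℝ) (N : ℝ) : Prop where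
  nonneg : 0 ≤ N
  contDiffOn : ContDiffOn ℝ (⌊t⌋₊ : ℕ) f S
  norm_le : ∀ j ≤ ⌊t⌋₊, ∀ x ∈ S, ‖iteratedFDerivWithin ℝ j f S x‖ ≤ N
  holder : ∀ x ∈ S, ∀ y ∈ S,
    ‖iteratedFDerivWithin ℝ ⌊t⌋₊ f S x - iteratedFDerivWithin ℝ ⌊t⌋₊ f S y‖
      ≤ N * ‖x - y‖ ^ (t - (⌊t⌋₊ : ℝ))

section Taylor

variable {E : Type*} [NormedAddCommGroup E] [NormedSpace ℝ E]

theorem HasCtBound.abs_sub_taylor_le {t : ℝ} (ht : 0 ≤ t) {S : Set E} (hS : UniqueDiffOn ℝ S)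
    {f : E → ℝ} {N : ℝ} (hf : HasCtBound t S f N) {x h : E}
    (hseg : ∀ τ ∈ Icc (0 : ℝ) 1, x + τ • h ∈ S) :
    |f (x + h) - ∑ j ∈ Finset.range (⌊t⌋₊ + 1),
      iteratedFDerivWithin ℝ j f S x (fun _ => h) / (j.factorial : ℝ)| ≤ N * ‖h‖ ^ t := by
  set n := ⌊t⌋₊ with hn
  have hnt : (n : ℝ) ≤ t := Nat.floor_le ht
  have hx : x ∈ S := by simpa using hseg 0 (by simp)
  have key := abs_sub_taylor_sum_le (n := n)
    (F := fun j τ => iteratedFDerivWithin ℝ j f S (x + τ • h) (fun _ => h))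
    (K := N * ‖h‖ ^ t) (fun j hj τ hτ => ?_) (fun τ hτ => ?_) (τ := 1) (by simp)
  · simpa using key
  · have h1 : HasFDerivWithinAt (iteratedFDerivWithin ℝ j f S)
        (fderivWithin ℝ (iteratedFDerivWithin ℝ j f S) S (x + τ • h)) S (x + τ • h) :=
      (hf.contDiffOn.differentiableOn_iteratedFDerivWithin (by exact_mod_cast hj) hS _
        (hseg τ hτ)).hasFDerivWithinAt
    have h2 : HasDerivWithinAt (fun σ : ℝ => x + σ • h) h (Icc 0 1) τ := by
      simpa using (((hasDerivAt_id τ).smul_const h).const_add x).hasDerivWithinAt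
    have h3 := h1.comp_hasDerivWithinAt τ h2 fun σ hσ => hseg σ hσ
    have h4 := (ContinuousMultilinearMap.apply ℝ (fun _ : Fin j => E) ℝ
      (fun _ => h)).hasFDerivAt.comp_hasDerivWithinAt τ h3
    exact h4
  · have h1 := hf.holder _ (hseg τ hτ) _ hx
    have h2 : ‖x + τ • h - x‖ ≤ ‖h‖ := by
      rw [add_sub_cancel_left, norm_smul, Real.norm_of_nonneg hτ.1]
      exact mul_le_of_le_one_left (norm_nonneg _) hτ.2
    simp only [zero_smul, add_zero]
    rw [← sub_apply, ← Real.norm_eq_abs]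
    refine (ContinuousMultilinearMap.le_opNorm _ _).trans ?_
    calc _ ≤ (N * ‖h‖ ^ (t - (n : ℝ))) * ∏ _i : Fin n, ‖h‖ := by
          gcongr
          refine h1.trans ?_
          have := hf.nonneg
          gcongr
      _ = N * ‖h‖ ^ t := by
          rw [Finset.prod_const, Finset.card_univ, Fintype.card_fin, mul_assoc,
            ← Real.rpow_natCast, ← Real.rpow_add_of_nonneg (norm_nonneg _) (by linarith)
            (by positivity), sub_add_cancel]

/-- Derivatives of truncated homogeneous polynomials are controlled by the coefficients. -/
theorem exists_norm_iteratedFDeriv_mul_multilinear_le {χ : E → ℝ} (hχ : ContDiff ℝ (⊤ : ℕ∞) χ)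
    (hχc : HasCompactSupport χ) (j i : ℕ) :
    ∃ C, 0 ≤ C ∧ ∀ (a : E [×j]→L[ℝ] ℝ) (h : E),
      ‖iteratedFDeriv ℝ i (fun h => χ h * a fun _ => h) h‖ ≤ C * ‖a‖ := by
  have hχb : ∀ l, ∃ B, ∀ h, ‖iteratedFDeriv ℝ l χ h‖ ≤ B := fun l =>
    (hχc.iteratedFDeriv l).exists_bound_of_continuous
      (hχ.continuous_iteratedFDeriv (by exact_mod_cast le_top))
  choose B hB using hχb
  have hB0 : ∀ l, 0 ≤ B l := fun l => (norm_nonneg _).trans (hB l 0)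
  obtain ⟨R, hR⟩ := hχc.isCompact.isBounded.exists_norm_le
  set R' := max R 0
  refine ⟨∑ l ∈ Finset.range (i + 1),
    (i.choose l : ℝ) * B l * ((j.descFactorial (i - l) : ℝ) * R' ^ (j - (i - l))),
    Finset.sum_nonneg fun l _ => by have := hB0 l; positivity, fun a h => ?_⟩
  let D : E →L[ℝ] (Fin j → E) := ContinuousLinearMap.pi fun _ => ContinuousLinearMap.id ℝ E
  have hD : ‖D‖ ≤ 1 :=
    ContinuousLinearMap.norm_pi_le_of_le (fun _ => ContinuousLinearMap.norm_id_le) zero_le_one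
  have hsm : ContDiff ℝ (⊤ : ℕ∞) (fun h => a fun _ => h) := a.contDiff.comp D.contDiff
  refine (norm_iteratedFDeriv_mul_le hχ hsm h (by exact_mod_cast le_top)).trans ?_
  rw [Finset.sum_mul]
  refine Finset.sum_le_sum fun l _ => ?_
  by_cases hh : h ∈ tsupport χ
  · have h1 : ‖iteratedFDeriv ℝ (i - l) (fun h => a fun _ => h) h‖ ≤
        (j.descFactorial (i - l) : ℝ) * R' ^ (j - (i - l)) * ‖a‖ := by
      have h2 := D.iteratedFDeriv_comp_right (n := (i - l : ℕ)) a.contDiff h (i := i - l) le_rfl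
      rw [show (fun h => a fun _ => h) = a ∘ D from rfl, h2]
      refine (ContinuousMultilinearMap.norm_compContinuousLinearMap_le _ _).trans ?_
      have h3 := a.norm_iteratedFDeriv_le (i - l) (D h)
      have h4 : ‖D h‖ ≤ R' :=
        (D.le_of_opNorm_le hD h).trans (by rw [one_mul]; exact (hR h hh).trans (le_max_left _ _))
      rw [Fintype.card_fin] at h3
      calc _ ≤ ((j.descFactorial (i - l) : ℝ) * ‖a‖ * ‖D h‖ ^ (j - (i - l))) * 1 := by
            gcongr
            rw [Finset.prod_const]
            exact pow_le_one₀ (norm_nonneg _) hD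
        _ ≤ ((j.descFactorial (i - l) : ℝ) * ‖a‖ * R' ^ (j - (i - l))) * 1 := by gcongr
        _ = _ := by ring
    calc _ ≤ (i.choose l : ℝ) * B l *
          ((j.descFactorial (i - l) : ℝ) * R' ^ (j - (i - l)) * ‖a‖) := by
          have := hB0 l
          gcongr
          exact hB l h
      _ = _ := by ring
  · have h1 : iteratedFDeriv ℝ l χ h = 0 := by
      by_contra hne
      exact hh (support_iteratedFDeriv_subset l hne)
    rw [h1, norm_zero]
    have := hB0 l
    simp only [mul_zero, zero_mul]
    positivity

end Taylor

open scoped Convolution in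
/-- Smoothing with a moment kernel: approximation order and derivative growth at every point from
which the scaled kernel only sees the set `S`. -/
theorem exists_smoothing_bound {E : Type} [NormedAddCommGroup E] [NormedSpace ℝ E]
    [FiniteDimensional ℝ E] [MeasurableSpace E] [BorelSpace E] (μ : Measure E) [μ.IsAddHaarMeasure]
    {t : ℝ} (ht : 0 < t) {k : ℕ} (htk : t ≤ k) {S : Set E} (hSc : IsCompact S)
    (hS : UniqueDiffOn ℝ S) {κ : E → ℝ} (hκ : ContDiff ℝ (⊤ : ℕ∞) κ) (hκc : HasCompactSupport κ)
    (hint : ∫ u, κ u ∂μ = 1) (hmom : ∀ j, 1 ≤ j → j ≤ ⌊t⌋₊ → ∀ a : E [×j]→L[ℝ] ℝ,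
      ∫ u, κ u * a (fun _ => u) ∂μ = 0) :
    ∃ C, 0 ≤ C ∧ ∀ (f : E → ℝ) (N : ℝ), HasCtBound t S f N → ∀ ε ∈ Ioc (0 : ℝ) 1,
      ∃ g : E → ℝ, ContDiff ℝ (⊤ : ℕ∞) g ∧
        ∀ x ∈ S, (∀ u ∈ tsupport κ, ∀ σ ∈ Icc (0 : ℝ) 1, x - σ • u ∈ S) →
          |g x - f x| ≤ C * ε ^ t * N ∧
          ∀ i ≤ k, ‖iteratedFDeriv ℝ i g x‖ ≤ C * ε ^ (t - k) * N := by
  set n := ⌊t⌋₊ with hn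
  obtain ⟨B₀, hB₀⟩ := hκc.isCompact.isBounded.exists_norm_le
  obtain ⟨B, hB0, hB⟩ : ∃ B, 0 ≤ B ∧ ∀ u ∈ tsupport κ, ‖u‖ ≤ B :=
    ⟨max B₀ 0, le_max_right _ _, fun u hu => (hB₀ u hu).trans (le_max_left _ _)⟩
  let χ : ContDiffBump (0 : E) := ⟨B + 1, B + 2, by linarith, by linarith⟩
  have hχ : ContDiff ℝ (⊤ : ℕ∞) (χ : E → ℝ) := χ.contDiff
  choose Q hQ0 hQ using
    exists_norm_iteratedFDeriv_mul_multilinear_le hχ χ.hasCompactSupport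
  set A : ℕ → ℝ := fun i => ∫ u, ‖iteratedFDeriv ℝ i κ u‖ ∂μ with hA
  have hA0 : ∀ i, 0 ≤ A i := fun i => integral_nonneg fun _ => norm_nonneg _
  have hAint : ∀ i, Integrable (fun u => ‖iteratedFDeriv ℝ i κ u‖) μ := fun i =>
    ((hκ.continuous_iteratedFDeriv (mod_cast le_top)).integrable_of_hasCompactSupport
      (hκc.iteratedFDeriv i)).norm
  set CP : ℕ → ℝ := fun i => ∑ j ∈ Finset.range (n + 1), Q j i with hCP
  have hCP0 : ∀ i, 0 ≤ CP i := fun i => Finset.sum_nonneg fun j _ => hQ0 j i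
  have hcoef0 : ∀ i, 0 ≤ B ^ t * A i + CP i * A 0 := fun i => by
    have := hA0 i; have := hA0 0; have := hCP0 i; positivity
  set C := ∑ i ∈ Finset.range (k + 1), (B ^ t * A i + CP i * A 0) with hC
  have hCle : ∀ i ≤ k, B ^ t * A i + CP i * A 0 ≤ C := fun i hi =>
    Finset.single_le_sum (f := fun i => B ^ t * A i + CP i * A 0) (fun i _ => hcoef0 i)
      (Finset.mem_range.2 (by omega))
  refine ⟨C, Finset.sum_nonneg fun i _ => hcoef0 i, fun f N hf ε hε => ?_⟩
  have hε0 := hε.1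
  have hN := hf.nonneg
  set L := ContinuousLinearMap.mul ℝ ℝ with hL
  have hL1 : ‖L‖ ≤ 1 := ContinuousLinearMap.opNorm_mul_le ℝ ℝ
  set fε : E → ℝ := fun y => S.indicator f (ε • y) with hfε
  have hfεint : Integrable fε μ :=
    ((integrable_indicator_iff hSc.measurableSet).2
      (hf.contDiffOn.continuousOn.integrableOn_compact hSc)).comp_smul hε0.ne'
  have hGsm : ContDiff ℝ (⊤ : ℕ∞) (fε ⋆[L, μ] κ) :=
    hκc.contDiff_convolution_right L hfεint.locallyIntegrable hκ
  refine ⟨fun y => (fε ⋆[L, μ] κ) (ε⁻¹ • y), hGsm.comp (contDiff_const_smul _),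
    fun x hx hcone => ?_⟩
  set X := ε⁻¹ • x with hX
  have hεX : ε • X = x := smul_inv_smul₀ hε0.ne' x
  let a : (j : ℕ) → E [×j]→L[ℝ] ℝ :=
    fun j => (j.factorial : ℝ)⁻¹ • iteratedFDerivWithin ℝ j f S x
  have ha : ∀ j ≤ n, ‖a j‖ ≤ N := fun j hj => by
    rw [norm_smul, norm_inv, Real.norm_natCast]
    refine (mul_le_of_le_one_left (norm_nonneg _) ?_).trans (hf.norm_le j hj x hx)
    exact inv_le_one_of_one_le₀ (mod_cast Nat.one_le_iff_ne_zero.2 j.factorial_ne_zero)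
  set P : E → ℝ := fun h => ∑ j ∈ Finset.range (n + 1), χ h * a j (fun _ => h) with hP
  have hterm : ∀ j, ContDiff ℝ (⊤ : ℕ∞) (fun h => χ h * a j (fun _ => h)) := fun j =>
    hχ.mul ((a j).contDiff.comp (ContinuousLinearMap.pi
      fun _ : Fin j => ContinuousLinearMap.id ℝ E).contDiff)
  have hPsm : ContDiff ℝ (⊤ : ℕ∞) P := ContDiff.sum fun j _ => hterm j
  have hPc : HasCompactSupport P := χ.hasCompactSupport.mono fun h hh hχh => hh <| by
    simp only [hP]
    exact Finset.sum_eq_zero fun j _ => by rw [hχh, zero_mul]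
  have hPb : ∀ i h, ‖iteratedFDeriv ℝ i P h‖ ≤ CP i * N := fun i h => by
    rw [hP, iteratedFDeriv_fun_sum_apply fun j _ =>
      ((hterm j).of_le (mod_cast le_top)).contDiffAt]
    refine (norm_sum_le _ _).trans ?_
    rw [hCP, Finset.sum_mul]
    refine Finset.sum_le_sum fun j hj => (hQ j i (a j) h).trans ?_
    have := hQ0 j i
    gcongr
    exact ha j (by simpa [Nat.lt_succ_iff] using hj)
  have hP1 : ∀ u ∈ tsupport κ,
      P (-(ε • u)) = ∑ j ∈ Finset.range (n + 1), a j (fun _ => -(ε • u)) := fun u hu => by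
    have h1 : χ (-(ε • u)) = 1 := χ.one_of_mem_closedBall <| by
      rw [mem_closedBall_zero_iff, norm_neg, norm_smul, Real.norm_of_nonneg hε0.le]
      calc ε * ‖u‖ ≤ 1 * B := by gcongr; exacts [hε.2, hB u hu]
        _ ≤ B + 1 := by linarith
    simp only [hP, h1, one_mul]
  set Pε : E → ℝ := fun y => P (ε • y - x) with hPε
  have hPεsm : ContDiff ℝ (⊤ : ℕ∞) Pε :=
    hPsm.comp ((contDiff_const_smul ε).sub contDiff_const)
  have hPεc : HasCompactSupport Pε := hPc.comp_homeomorph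
    ((Homeomorph.smulOfNeZero ε hε0.ne').trans (Homeomorph.subRight x))
  have hPεint : Integrable Pε μ := hPεsm.continuous.integrable_of_hasCompactSupport hPεc
  have hκint : Integrable κ μ := hκ.continuous.integrable_of_hasCompactSupport hκc
  set R : E → ℝ := fun y => fε y - Pε y with hR
  have hRint : Integrable R μ := hfεint.sub hPεint
  have hRb : ∀ u ∈ tsupport κ, ‖R (X - u)‖ ≤ N * ε ^ t * B ^ t := fun u hu => by
    have h1 : ε • (X - u) = x + -(ε • u) := by rw [smul_sub, hεX, sub_eq_add_neg]
    have hmem : ∀ σ ∈ Icc (0 : ℝ) 1, x + σ • -(ε • u) ∈ S := fun σ hσ => by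
      have := hcone u hu (σ * ε) ⟨by have := hσ.1; positivity, mul_le_one₀ hσ.2 hε0.le hε.2⟩
      rwa [smul_neg, smul_smul, ← sub_eq_add_neg]
    have h2 := hf.abs_sub_taylor_le ht.le hS hmem
    have h3 : ‖-(ε • u)‖ ^ t ≤ ε ^ t * B ^ t := by
      rw [norm_neg, norm_smul, Real.norm_of_nonneg hε0.le, Real.mul_rpow hε0.le (norm_nonneg _)]
      gcongr
      exact hB u hu
    have hx1 : x + -(ε • u) ∈ S := by simpa using hmem 1 (by simp)
    simp only [hR, hfε, hPε, h1]
    rw [add_sub_cancel_left, hP1 u hu, indicator_of_mem hx1, Real.norm_eq_abs]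
    calc _ ≤ N * ‖-(ε • u)‖ ^ t := by
          convert h2 using 5 with j hj
          simp only [a, smul_apply, smul_eq_mul]
          rw [inv_mul_eq_div]
      _ ≤ N * (ε ^ t * B ^ t) := by gcongr
      _ = _ := by ring
  have hsplit : fε ⋆[L, μ] κ = R ⋆[L, μ] κ + Pε ⋆[L, μ] κ := by
    rw [← (hκc.convolutionExists_right L hRint.locallyIntegrable hκ.continuous).add_distrib
      (hκc.convolutionExists_right L hPεint.locallyIntegrable hκ.continuous)]
    congr 1
    funext y
    simp [hR]
  have hRconv : ∀ i, ‖iteratedFDeriv ℝ i (R ⋆[L, μ] κ) X‖ ≤ N * ε ^ t * B ^ t * A i := fun i => by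
    refine (norm_iteratedFDeriv_convolution_right_le hRint.locallyIntegrable L hκ hκc X i).trans ?_
    have h1 : ∫ u, ‖R (X - u)‖ * ‖iteratedFDeriv ℝ i κ u‖ ∂μ ≤ N * ε ^ t * B ^ t * A i := by
      rw [hA, ← integral_const_mul]
      refine integral_mono_of_nonneg (Filter.Eventually.of_forall fun u => by positivity)
        ((hAint i).const_mul _) (Filter.Eventually.of_forall fun u => ?_)
      by_cases hu : u ∈ tsupport κ
      · exact mul_le_mul_of_nonneg_right (hRb u hu) (norm_nonneg _)
      · have : iteratedFDeriv ℝ i κ u = 0 := by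
          by_contra hne
          exact hu (support_iteratedFDeriv_subset i hne)
        simp [this]
    refine (mul_le_of_le_one_left (integral_nonneg fun u => ?_) hL1).trans h1
    positivity
  have hPconv : ∀ i, ‖iteratedFDeriv ℝ i (Pε ⋆[L, μ] κ) X‖ ≤ ε ^ i * (CP i * N) * A 0 := fun i => by
    rw [← convolution_flip]
    refine (norm_iteratedFDeriv_convolution_right_le hκint.locallyIntegrable L.flip hPεsm hPεc
      X i).trans ?_
    have h2 : ∀ u, ‖iteratedFDeriv ℝ i Pε u‖ ≤ ε ^ i * (CP i * N) := fun u => by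
      have h3 := norm_iteratedFDeriv_comp_const_smul_le (i := i) (g := fun z => P (z - x))
        ((hPsm.comp (contDiff_id.sub contDiff_const)).of_le (mod_cast le_top)) ε u
      rw [iteratedFDeriv_comp_sub, abs_of_pos hε0] at h3
      refine h3.trans ?_
      gcongr
      exact hPb i _
    have h1 : ∫ u, ‖κ (X - u)‖ * ‖iteratedFDeriv ℝ i Pε u‖ ∂μ ≤ ε ^ i * (CP i * N) * A 0 := by
      have h4 : A 0 = ∫ u, ‖κ (X - u)‖ ∂μ := by
        simp only [hA, norm_iteratedFDeriv_zero]
        exact (integral_sub_left_eq_self (fun u => ‖κ u‖) μ X).symm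
      rw [h4, ← integral_const_mul]
      refine integral_mono_of_nonneg (Filter.Eventually.of_forall fun u => by positivity)
        (((hκint.comp_sub_left X).norm).const_mul _) (Filter.Eventually.of_forall fun u => ?_)
      dsimp only
      rw [mul_comm]
      exact mul_le_mul_of_nonneg_right (h2 u) (norm_nonneg _)
    refine (mul_le_of_le_one_left (integral_nonneg fun u => ?_) ?_).trans h1
    · positivity
    · rwa [ContinuousLinearMap.opNorm_flip]
  have hRsm : ContDiff ℝ (⊤ : ℕ∞) (R ⋆[L, μ] κ) :=
    hκc.contDiff_convolution_right L hRint.locallyIntegrable hκ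
  have hPcsm : ContDiff ℝ (⊤ : ℕ∞) (Pε ⋆[L, μ] κ) :=
    hκc.contDiff_convolution_right L hPεint.locallyIntegrable hκ
  constructor
  · have hPval : (Pε ⋆[L, μ] κ) X = f x := by
      rw [convolution_eq_swap]
      have h1 : ∀ u, L (Pε (X - u)) (κ u) =
          ∑ j ∈ Finset.range (n + 1), (-ε) ^ j * (κ u * a j (fun _ => u)) := fun u => by
        by_cases hu : u ∈ tsupport κ
        · have h2 : ε • (X - u) - x = -(ε • u) := by rw [smul_sub, hεX, sub_sub_cancel_left]
          simp only [hPε, h2, hP1 u hu, hL, ContinuousLinearMap.mul_apply', Finset.sum_mul]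
          refine Finset.sum_congr rfl fun j _ => ?_
          have h3 := (a j).map_smul_univ (fun _ => -ε) (fun _ => u)
          simp only [neg_smul, Finset.prod_const, Finset.card_univ, Fintype.card_fin,
            smul_eq_mul] at h3
          rw [h3]
          ring
        · simp [image_eq_zero_of_notMem_tsupport hu]
      simp_rw [h1]
      rw [integral_finsetSum _ fun j _ => ?_, Finset.sum_range_succ']
      · rw [Finset.sum_eq_zero fun j hj => ?_]
        · have h4 : ∀ u : E, a 0 (fun _ => u) = f x := fun u => by simp [a]
          simp only [h4, pow_zero, one_mul, zero_add]
          rw [integral_mul_const, hint, one_mul]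
        · rw [integral_const_mul, hmom (j + 1) (by omega)
            (by have := Finset.mem_range.1 hj; omega), mul_zero]
      · refine Integrable.const_mul (Continuous.integrable_of_hasCompactSupport ?_
          hκc.mul_right) _
        have := hκ.continuous
        fun_prop
    have h5 := hRconv 0
    rw [norm_iteratedFDeriv_zero, Real.norm_eq_abs] at h5
    simp only [hsplit, Pi.add_apply]
    rw [← hX, hPval, add_sub_cancel_right]
    refine h5.trans ?_
    have h6 : B ^ t * A 0 ≤ C := by
      have := hCle 0 (Nat.zero_le _)
      have := mul_nonneg (hCP0 0) (hA0 0)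
      linarith
    calc N * ε ^ t * B ^ t * A 0 = B ^ t * A 0 * ε ^ t * N := by ring
      _ ≤ C * ε ^ t * N := by gcongr
  · intro i hi
    have h1 := norm_iteratedFDeriv_comp_const_smul_le (i := i)
      (hGsm.of_le (mod_cast le_top)) ε⁻¹ x
    refine h1.trans ?_
    rw [← hX, abs_of_pos (inv_pos.2 hε0), hsplit, iteratedFDeriv_add_apply
      (hRsm.of_le (mod_cast le_top)).contDiffAt (hPcsm.of_le (mod_cast le_top)).contDiffAt]
    have h2 : ε⁻¹ ^ i * ε ^ t ≤ ε ^ (t - k) := by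
      rw [inv_pow, ← Real.rpow_natCast, ← Real.rpow_neg hε0.le, ← Real.rpow_add hε0]
      refine Real.rpow_le_rpow_of_exponent_ge hε0 hε.2 ?_
      have : (i : ℝ) ≤ k := mod_cast hi
      linarith
    have h3 : 1 ≤ ε ^ (t - k) :=
      Real.one_le_rpow_of_pos_of_le_one_of_nonpos hε0 hε.2 (by linarith)
    have h4 : ε⁻¹ ^ i * ε ^ i = 1 := by
      rw [← mul_pow, inv_mul_cancel₀ hε0.ne', one_pow]
    have := hA0 i
    have := hA0 0
    have := hCP0 i
    calc _ ≤ ε⁻¹ ^ i * (N * ε ^ t * B ^ t * A i + ε ^ i * (CP i * N) * A 0) := by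
          gcongr
          exact (norm_add_le _ _).trans (add_le_add (hRconv i) (hPconv i))
      _ = (ε⁻¹ ^ i * ε ^ t) * (B ^ t * A i * N) + (ε⁻¹ ^ i * ε ^ i) * (CP i * A 0 * N) := by ring
      _ ≤ ε ^ (t - k) * (B ^ t * A i * N) + ε ^ (t - k) * (CP i * A 0 * N) := by
          rw [h4]
          gcongr
      _ = (B ^ t * A i + CP i * A 0) * ε ^ (t - k) * N := by ring
      _ ≤ C * ε ^ (t - k) * N := by
          gcongr
          exact hCle i hi
theorem nonpos_of_mem_closure_of_inter_eq {E : Type*} [TopologicalSpace E] {Ω U : Set E}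
    {φ : E → ℝ} (hU : IsOpen U) (hφ : Continuous φ)
    (h : Ω ∩ U = {y ∈ U | φ y < 0}) {x : E} (hx : x ∈ closure Ω) (hxU : x ∈ U) : φ x ≤ 0 := by
  have h1 : x ∈ closure (Ω ∩ U) := hU.closure_inter ⟨hx, hxU⟩
  rw [h] at h1
  exact closure_minimal (fun y hy => hy.2.le) (isClosed_le hφ continuous_const) h1

theorem eq_zero_of_mem_frontier_of_inter_eq {E : Type*} [TopologicalSpace E] {Ω U : Set E}
    {φ : E → ℝ} (hΩ : IsOpen Ω) (hU : IsOpen U) (hφ : Continuous φ)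
    (h : Ω ∩ U = {y ∈ U | φ y < 0}) {x : E} (hx : x ∈ frontier Ω) (hxU : x ∈ U) : φ x = 0 := by
  refine le_antisymm (nonpos_of_mem_closure_of_inter_eq hU hφ h hx.1 hxU) ?_
  by_contra! hlt
  have : x ∈ Ω ∩ U := by rw [h]; exact ⟨hxU, hlt⟩
  rw [hΩ.frontier_eq] at hx
  exact hx.2 this.1

section Geometry

variable {E : Type*} [NormedAddCommGroup E] [NormedSpace ℝ E] {Ω U : Set E} {φ : E → ℝ}

theorem exists_apply_eq_one_of_ne_zero {ℓ : E →L[ℝ] ℝ} (h : ℓ ≠ 0) : ∃ v, ℓ v = 1 := by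
  obtain ⟨v, hv⟩ := DFunLike.ne_iff.1 h
  exact ⟨(ℓ v)⁻¹ • v, by rw [map_smul, smul_eq_mul]; exact inv_mul_cancel₀ hv⟩

theorem mem_frontier_of_eq_zero_of_inter_eq (hΩ : IsOpen Ω) (hU : IsOpen U)
    (h : Ω ∩ U = {y ∈ U | φ y < 0}) {x : E} (hxU : x ∈ U) (hx : φ x = 0)
    (hd : fderiv ℝ φ x ≠ 0) : x ∈ frontier Ω := by
  rw [hΩ.frontier_eq]
  refine ⟨?_, fun hxΩ => ?_⟩
  · by_contra hcl
    refine hd (IsLocalMin.fderiv_eq_zero ?_)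
    filter_upwards [hU.mem_nhds hxU, isClosed_closure.isOpen_compl.mem_nhds hcl] with y hyU hy
    rw [hx]
    by_contra! hlt
    have : y ∈ Ω ∩ U := by rw [h]; exact ⟨hyU, hlt⟩
    exact hy (subset_closure this.1)
  · have : x ∈ {y ∈ U | φ y < 0} := by rw [← h]; exact ⟨hxΩ, hxU⟩
    exact this.2.ne hx

/-- A smoothly bounded open set satisfies a uniform local cone condition. -/
theorem HasSmoothBoundary.exists_cone (hΩ : IsOpen Ω) (h : HasSmoothBoundary Ω) {x₀ : E}
    (hx₀ : x₀ ∈ closure Ω) :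
    ∃ V : Set E, IsOpen V ∧ x₀ ∈ V ∧ ∃ (w : E) (r : ℝ), 0 < r ∧ ∀ x ∈ V ∩ closure Ω,
      ∀ y ∈ closedBall w r, ∀ τ ∈ Icc (0 : ℝ) 1, x - τ • y ∈ closure Ω := by
  by_cases hxΩ : x₀ ∈ Ω
  · obtain ⟨R, hR, hball⟩ := Metric.isOpen_iff.1 hΩ x₀ hxΩ
    refine ⟨ball x₀ (R / 2), isOpen_ball, mem_ball_self (by positivity), 0, R / 3, by positivity,
      fun x hx y hy τ hτ => subset_closure (hball ?_)⟩
    rw [mem_closedBall, dist_zero_right] at hy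
    have h1 := mem_ball_iff_norm.1 hx.1
    have h2 : ‖τ • y‖ ≤ ‖y‖ := by
      rw [norm_smul, Real.norm_of_nonneg hτ.1]
      exact mul_le_of_le_one_left (norm_nonneg _) hτ.2
    rw [mem_ball_iff_norm, sub_right_comm]
    have := norm_sub_le (x - x₀) (τ • y)
    linarith
  obtain ⟨U, φ, hU, hxU, hφ, hd, hUφ⟩ := h x₀ (by rw [hΩ.frontier_eq]; exact ⟨hx₀, hxΩ⟩)
  obtain ⟨v, hv⟩ := exists_apply_eq_one_of_ne_zero (hd x₀ hxU)
  have hcont : Continuous fun p : E × E => fderiv ℝ φ p.1 p.2 :=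
    ((hφ.continuous_fderiv (by simp)).comp continuous_fst).clm_apply continuous_snd
  have hev : ∀ᶠ p : E × E in 𝓝 (x₀, v), p.1 ∈ U ∧ 0 < fderiv ℝ φ p.1 p.2 :=
    (continuous_fst.continuousAt.eventually (hU.mem_nhds hxU)).and
      (hcont.continuousAt.eventually (lt_mem_nhds (by simp [hv])))
  obtain ⟨ρ, hρ, hball⟩ := Metric.eventually_nhds_iff_ball.1 hev
  set δ : ℝ := ρ / 2 / (‖v‖ + ρ) with hδ
  have hδ0 : 0 < δ := by positivity
  refine ⟨ball x₀ (ρ / 2), isOpen_ball, mem_ball_self (by positivity), δ • v, δ * (ρ / 2),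
    by positivity, fun x hx y hy τ hτ => ?_⟩
  obtain ⟨z, rfl⟩ : ∃ z, y = δ • z := ⟨δ⁻¹ • y, (smul_inv_smul₀ hδ0.ne' y).symm⟩
  have hz : ‖z - v‖ ≤ ρ / 2 := by
    rw [mem_closedBall_iff_norm, ← smul_sub, norm_smul, Real.norm_of_nonneg hδ0.le] at hy
    exact le_of_mul_le_mul_left hy hδ0
  have hzn : ‖δ • z‖ ≤ ρ / 2 := by
    have h1 : ‖z‖ ≤ ‖v‖ + ρ := by
      have := norm_add_le (z - v) v
      rw [sub_add_cancel] at this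
      linarith
    rw [norm_smul, Real.norm_of_nonneg hδ0.le]
    calc _ ≤ δ * (‖v‖ + ρ) := by gcongr
      _ = ρ / 2 := by rw [hδ]; field_simp
  have hseg : ∀ σ ∈ Icc (0 : ℝ) 1, x - σ • δ • z ∈ U ∧ 0 < fderiv ℝ φ (x - σ • δ • z) z := by
    intro σ hσ
    refine hball (x - σ • δ • z, z) ?_
    rw [← ball_prod_same]
    refine ⟨?_, mem_ball_iff_norm.2 (by simp only; linarith)⟩
    have h1 := mem_ball_iff_norm.1 hx.1
    have h2 : ‖σ • δ • z‖ ≤ ‖δ • z‖ := by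
      rw [norm_smul, Real.norm_of_nonneg hσ.1]
      exact mul_le_of_le_one_left (norm_nonneg _) hσ.2
    rw [mem_ball_iff_norm]
    simp only
    rw [sub_right_comm]
    have := norm_sub_le (x - x₀) (σ • δ • z)
    linarith
  have hder : ∀ σ : ℝ, HasDerivAt (fun σ : ℝ => φ (x - σ • δ • z))
      (fderiv ℝ φ (x - σ • δ • z) (-(δ • z))) σ := fun σ => by
    have h1 : HasDerivAt (fun σ : ℝ => x - σ • δ • z) (-(δ • z)) σ := by
      simpa using ((hasDerivAt_id σ).smul_const (δ • z)).const_sub x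
    exact ((hφ.differentiable (by simp)) _).hasFDerivAt.comp_hasDerivAt σ h1
  have hanti : StrictAntiOn (fun σ : ℝ => φ (x - σ • δ • z)) (Icc 0 1) := by
    refine strictAntiOn_of_deriv_neg (convex_Icc 0 1)
      (fun σ _ => (hder σ).continuousAt.continuousWithinAt) fun σ hσ => ?_
    rw [(hder σ).deriv, map_neg, map_smul, smul_eq_mul]
    have := (hseg σ (interior_subset hσ)).2
    have := mul_pos hδ0 this
    linarith
  rcases hτ.1.eq_or_lt with h0 | h0
  · rw [← h0, zero_smul, sub_zero]; exact hx.2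
  · have h1 := hanti (by simp) hτ h0
    have h2 := nonpos_of_mem_closure_of_inter_eq hU hφ.continuous hUφ hx.2
      (by simpa using (hseg 0 (by simp)).1)
    simp only [zero_smul, sub_zero] at h1
    have : x - τ • δ • z ∈ Ω ∩ U := by
      rw [hUφ]; exact ⟨(hseg τ hτ).1, h1.trans_le h2⟩
    exact subset_closure this.1

theorem HasSmoothBoundary.uniqueDiffOn_closure (hΩ : IsOpen Ω) (h : HasSmoothBoundary Ω) :
    UniqueDiffOn ℝ (closure Ω) := by
  intro x hx
  obtain ⟨V, -, hxV, w, r, hr, hc⟩ := h.exists_cone hΩ hx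
  refine ⟨?_, subset_closure hx⟩
  have hsub : ball (-w) r ⊆ tangentConeAt ℝ (closure Ω) x := by
    intro y hy
    have hy' : -y ∈ closedBall w r := by
      rw [mem_closedBall_iff_norm]
      rw [mem_ball_iff_norm] at hy
      rw [← norm_neg, neg_sub, sub_neg_eq_add, add_comm]
      simpa using hy.le
    have : x + y - x ∈ tangentConeAt ℝ (closure Ω) x := by
      refine mem_tangentConeAt_of_segment_subset ?_
      rw [segment_eq_image']
      rintro _ ⟨θ, hθ, rfl⟩
      simpa using hc x ⟨hxV, hx⟩ (-y) hy' θ hθ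
    simpa using this
  have htop : Submodule.span ℝ (tangentConeAt ℝ (closure Ω) x) = ⊤ := by
    refine Submodule.eq_top_of_nonempty_interior' _ ⟨-w, mem_interior.2 ⟨ball (-w) r, ?_,
      isOpen_ball, mem_ball_self hr⟩⟩
    exact hsub.trans Submodule.subset_span
  rw [htop]
  exact dense_univ

/-- A local retraction onto a regular level set. -/
theorem exists_local_retraction [CompleteSpace E] (hφ : ContDiff ℝ (⊤ : ℕ∞) φ) {x₀ : E}
    (hx₀ : φ x₀ = 0) (hd : fderiv ℝ φ x₀ ≠ 0) :
    ∃ π : E → E, ContDiffAt ℝ (⊤ : ℕ∞) π x₀ ∧ π x₀ = x₀ ∧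
      ∀ᶠ x in 𝓝 x₀, φ (π x) = 0 ∧ (φ x = 0 → π x = x) := by
  obtain ⟨v, hv⟩ := exists_apply_eq_one_of_ne_zero hd
  set ℓ := fderiv ℝ φ x₀ with hℓ
  set Ψ : E → E := fun x => x + (φ x - ℓ (x - x₀)) • v with hΨ
  have hΨs : ContDiff ℝ (⊤ : ℕ∞) Ψ :=
    contDiff_id.add ((hφ.sub (ℓ.contDiff.comp (contDiff_id.sub contDiff_const))).smul
      contDiff_const)
  have hΨ0 : Ψ x₀ = x₀ := by simp [hΨ, hx₀]
  have hΨd : HasFDerivAt Ψ ((ContinuousLinearEquiv.refl ℝ E : E ≃L[ℝ] E) : E →L[ℝ] E) x₀ := by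
    have h1 : HasFDerivAt φ ℓ x₀ := ((hφ.differentiable (by simp)) x₀).hasFDerivAt
    have h2 : HasFDerivAt (fun x => ℓ (x - x₀)) ℓ x₀ :=
      ℓ.hasFDerivAt.comp x₀ ((hasFDerivAt_id x₀).sub_const x₀)
    have h3 := (hasFDerivAt_id x₀).add ((h1.sub h2).smul_const v)
    refine h3.congr_fderiv ?_
    ext y
    simp
  have hne : ((⊤ : ℕ∞) : WithTop ℕ∞) ≠ 0 := by simp
  have hs := hΨs.contDiffAt (x := x₀)
  have hstrict : HasStrictFDerivAt Ψ _ x₀ := hs.hasStrictFDerivAt' hΨd hne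
  set inv := hs.localInverse hΨd hne with hinv
  have hinvs : ContDiffAt ℝ (⊤ : ℕ∞) inv x₀ := by
    have := hs.to_localInverse hΨd hne
    rwa [hΨ0] at this
  have hr : ∀ᶠ y in 𝓝 x₀, Ψ (inv y) = y := by
    have := hstrict.eventually_right_inverse
    rwa [hΨ0] at this
  have hl : ∀ᶠ x in 𝓝 x₀, inv (Ψ x) = x := hstrict.eventually_left_inverse
  set θ : E → E := fun x => Ψ x - φ x • v with hθ
  have hθs : ContDiff ℝ (⊤ : ℕ∞) θ := hΨs.sub (hφ.smul contDiff_const)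
  have hθ0 : θ x₀ = x₀ := by simp [hθ, hΨ0, hx₀]
  have hφΨ : ∀ z, φ z = ℓ (Ψ z - x₀) := fun z => by
    have : Ψ z - x₀ = (z - x₀) + (φ z - ℓ (z - x₀)) • v := by simp only [hΨ]; abel
    rw [this, map_add, map_smul, hv, smul_eq_mul]
    ring
  refine ⟨inv ∘ θ, ContDiffAt.comp x₀ (by rwa [hθ0]) hθs.contDiffAt, ?_, ?_⟩
  · have := hl.self_of_nhds
    rw [hΨ0] at this
    simp [hθ0, this]
  · have hr' : ∀ᶠ x in 𝓝 x₀, Ψ (inv (θ x)) = θ x := by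
      have h1 : ∀ᶠ y in 𝓝 (θ x₀), Ψ (inv y) = y := by rwa [hθ0]
      exact (hθs.continuous.continuousAt (x := x₀)).eventually h1
    filter_upwards [hr', hl] with x h1 h2
    refine ⟨?_, fun h0 => ?_⟩
    · rw [hφΨ, Function.comp_apply, h1]
      have : θ x - x₀ = (Ψ x - x₀) - φ x • v := by simp only [hθ]; abel
      rw [this, map_sub, ← hφΨ, map_smul, hv, smul_eq_mul, mul_one, sub_self]
    · simp only [Function.comp_apply, hθ, h0, zero_smul, sub_zero, h2]

end Geometry

section Local

variable {E : Type} [NormedAddCommGroup E] [NormedSpace ℝ E] [FiniteDimensional ℝ E]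
  [MeasurableSpace E] [BorelSpace E] {Ω : Set E} {t : ℝ} {k : ℕ}

theorem exists_local_smoothing (hΩ : IsOpen Ω) (hb : Bornology.IsBounded Ω)
    (h : HasSmoothBoundary Ω) (ht : 0 < t) (htk : t ≤ k) {x₀ : E} (hx₀ : x₀ ∈ closure Ω) :
    ∃ V : Set E, IsOpen V ∧ x₀ ∈ V ∧ ∃ C, 0 ≤ C ∧ ∀ (f : E → ℝ) (N : ℝ),
      HasCtBound t (closure Ω) f N → ∀ ε ∈ Ioc (0 : ℝ) 1,
        ∃ g : E → ℝ, ContDiff ℝ (⊤ : ℕ∞) g ∧ ∀ x ∈ V ∩ closure Ω,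
          |g x - f x| ≤ C * ε ^ t * N ∧
          ∀ i ≤ k, ‖iteratedFDeriv ℝ i g x‖ ≤ C * ε ^ (t - k) * N := by
  obtain ⟨V, hV, hxV, w, r, hr, hcone⟩ := h.exists_cone hΩ hx₀
  obtain ⟨κ, hκ, hκc, hsupp, hint, hmom⟩ :=
    exists_moment_kernel (Measure.addHaar : Measure E) ⌊t⌋₊ w hr
  obtain ⟨C, hC, hsm⟩ := exists_smoothing_bound Measure.addHaar ht htk hb.isCompact_closure
    (h.uniqueDiffOn_closure hΩ) hκ hκc hint hmom
  refine ⟨V, hV, hxV, C, hC, fun f N hf ε hε => ?_⟩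
  obtain ⟨g, hg, hgx⟩ := hsm f N hf ε hε
  refine ⟨g, hg, fun x hx => hgx x hx.2 fun u hu σ hσ => ?_⟩
  obtain ⟨τ, hτ, y, hy, rfl⟩ := hsupp u hu
  rw [smul_smul]
  exact hcone x hx y hy _ ⟨mul_nonneg hσ.1 hτ.1, mul_le_one₀ hσ.2 hτ.1 hτ.2⟩

/-- Local approximation by functions which vanish on the boundary. -/
theorem exists_local_approx (hΩ : IsOpen Ω) (hb : Bornology.IsBounded Ω)
    (h : HasSmoothBoundary Ω) (ht : 0 < t) (htk : t ≤ k) {x₀ : E} (hx₀ : x₀ ∈ closure Ω) :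
    ∃ V : Set E, IsOpen V ∧ x₀ ∈ V ∧ ∃ C, 0 ≤ C ∧ ∀ (f : E → ℝ) (N : ℝ),
      HasCtBound t (closure Ω) f N → (∀ x ∈ frontier Ω, f x = 0) → ∀ ε ∈ Ioc (0 : ℝ) 1,
        ∃ g : E → ℝ, ContDiffOn ℝ k g V ∧ (∀ x ∈ V ∩ frontier Ω, g x = 0) ∧
          ∀ x ∈ V ∩ closure Ω, |g x - f x| ≤ C * ε ^ t * N ∧
            ∀ i ≤ k, ‖iteratedFDeriv ℝ i g x‖ ≤ C * ε ^ (t - k) * N := by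
  obtain ⟨V₀, hV₀, hxV₀, C, hC, hsm⟩ := exists_local_smoothing hΩ hb h ht htk hx₀
  by_cases hxΩ : x₀ ∈ Ω
  · refine ⟨V₀ ∩ Ω, hV₀.inter hΩ, ⟨hxV₀, hxΩ⟩, C, hC, fun f N hf _ ε hε => ?_⟩
    obtain ⟨g, hg, hgx⟩ := hsm f N hf ε hε
    refine ⟨g, (hg.of_le (mod_cast le_top)).contDiffOn, fun x hx => ?_,
      fun x hx => hgx x ⟨hx.1.1, hx.2⟩⟩
    have := hx.2
    rw [hΩ.frontier_eq] at this
    exact absurd hx.1.2 this.2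
  have hx₀' : x₀ ∈ frontier Ω := by rw [hΩ.frontier_eq]; exact ⟨hx₀, hxΩ⟩
  obtain ⟨U, φ, hU, hxU, hφ, hd, hUφ⟩ := h x₀ hx₀'
  have hfr : ∀ x ∈ frontier Ω, x ∈ U → φ x = 0 := fun x hx hxU =>
    eq_zero_of_mem_frontier_of_inter_eq hΩ hU hφ.continuous hUφ hx hxU
  have : CompleteSpace E := FiniteDimensional.complete ℝ E
  obtain ⟨π, hπ, hπ0, hπev⟩ := exists_local_retraction hφ (hfr x₀ hx₀' hxU) (hd x₀ hxU)
  have hπk : ContDiffAt ℝ k π x₀ := hπ.of_le (mod_cast le_top)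
  set D : ℝ := 1 + ∑ i ∈ Finset.range (k + 1), ‖iteratedFDeriv ℝ i π x₀‖ with hD
  have hD1 : 1 ≤ D := le_add_of_nonneg_right (Finset.sum_nonneg fun _ _ => norm_nonneg _)
  have hDev : ∀ᶠ x in 𝓝 x₀, ∀ i ∈ Finset.range (k + 1), ‖iteratedFDeriv ℝ i π x‖ < D := by
    rw [Filter.eventually_all_finset]
    intro i hi
    refine (hπk.continuousAt_iteratedFDeriv
      (by exact_mod_cast Nat.lt_succ_iff.1 (Finset.mem_range.1 hi))).norm.eventually
      (gt_mem_nhds ?_)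
    have := Finset.single_le_sum (f := fun i => ‖iteratedFDeriv ℝ i π x₀‖)
      (fun _ _ => norm_nonneg _) hi
    linarith
  have hmem : ∀ᶠ x in 𝓝 x₀, π x ∈ V₀ ∩ U :=
    hπ.continuousAt.eventually (by rw [hπ0]; exact (hV₀.inter hU).mem_nhds ⟨hxV₀, hxU⟩)
  obtain ⟨V, hVall, hV, hxV⟩ := _root_.eventually_nhds_iff.1
    (((hV₀.inter hU).eventually_mem ⟨hxV₀, hxU⟩).and (hmem.and (hπev.and
      ((hπk.eventually (by simp)).and hDev))))
  refine ⟨V, hV, hxV, C * (2 + k.factorial * D ^ k), by positivity, fun f N hf hf0 ε hε => ?_⟩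
  obtain ⟨g, hg, hgx⟩ := hsm f N hf ε hε
  have hε0 := hε.1
  have hN := hf.nonneg
  have hgk : ContDiff ℝ k g := hg.of_le (mod_cast le_top)
  have hπV : ContDiffOn ℝ k π V := fun x hx => (hVall x hx).2.2.2.1.contDiffWithinAt
  have hπfr : ∀ x ∈ V, π x ∈ frontier Ω := fun x hx =>
    mem_frontier_of_eq_zero_of_inter_eq hΩ hU hUφ (hVall x hx).2.1.2 (hVall x hx).2.2.1.1
      (hd _ (hVall x hx).2.1.2)
  have hcomp : ContDiffOn ℝ k (g ∘ π) V := hgk.comp_contDiffOn hπV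
  refine ⟨g - g ∘ π, hgk.contDiffOn.sub hcomp, fun x hx => ?_, fun x hx => ?_⟩
  · have := (hVall x hx.1).2.2.1.2 (hfr x hx.2 (hVall x hx.1).1.2)
    simp [this]
  · have hπx := hgx (π x) ⟨(hVall x hx.1).2.1.1, (hπfr x hx.1).1⟩
    have hx' := hgx x ⟨(hVall x hx.1).1.1, hx.2⟩
    have hbig : (1 : ℝ) + 1 ≤ 2 + k.factorial * D ^ k := by
      have : 0 ≤ (k.factorial : ℝ) * D ^ k := by positivity
      linarith
    refine ⟨?_, fun i hi => ?_⟩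
    · have h1 := hπx.1
      rw [hf0 _ (hπfr x hx.1), sub_zero] at h1
      calc |(g - g ∘ π) x - f x| = |(g x - f x) - g (π x)| := by
            simp only [Pi.sub_apply, Function.comp_apply]; congr 1; ring
        _ ≤ |g x - f x| + |g (π x)| := abs_sub _ _
        _ ≤ C * ε ^ t * N + C * ε ^ t * N := add_le_add hx'.1 h1
        _ = C * (1 + 1) * ε ^ t * N := by ring
        _ ≤ _ := by gcongr
    · have h1 : ‖iteratedFDerivWithin ℝ i (g ∘ π) V x‖ ≤
          (i.factorial : ℝ) * (C * ε ^ (t - k) * N) * D ^ i := by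
        refine norm_iteratedFDerivWithin_comp_le hgk.contDiffOn hπV (mod_cast hi)
          uniqueDiffOn_univ hV.uniqueDiffOn (mapsTo_univ _ _) hx.1 (fun j hj => ?_)
          fun j hj1 hj => ?_
        · rw [iteratedFDerivWithin_univ]
          exact hπx.2 j (hj.trans hi)
        · rw [iteratedFDerivWithin_of_isOpen j hV hx.1]
          refine ((hVall x hx.1).2.2.2.2 j (Finset.mem_range.2 (by omega))).le.trans ?_
          exact le_self_pow₀ hD1 (by omega)
      rw [iteratedFDerivWithin_of_isOpen i hV hx.1] at h1
      have hik : ((i : ℕ) : WithTop ℕ∞) ≤ k := mod_cast hi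
      rw [iteratedFDeriv_sub_apply (hgk.of_le hik).contDiffAt
        ((hcomp.contDiffAt (hV.mem_nhds hx.1)).of_le hik)]
      calc _ ≤ ‖iteratedFDeriv ℝ i g x‖ + ‖iteratedFDeriv ℝ i (g ∘ π) x‖ := norm_sub_le _ _
        _ ≤ C * ε ^ (t - k) * N + (i.factorial : ℝ) * (C * ε ^ (t - k) * N) * D ^ i :=
            add_le_add (hx'.2 i hi) h1
        _ ≤ C * ε ^ (t - k) * N + (k.factorial : ℝ) * (C * ε ^ (t - k) * N) * D ^ k := by
            gcongr
        _ = C * (1 + k.factorial * D ^ k) * ε ^ (t - k) * N := by ring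
        _ ≤ _ := by gcongr; norm_num

end Local

section Global

theorem contDiff_mul_of_tsupport_subset {E : Type*} [NormedAddCommGroup E] [NormedSpace ℝ E]
    {k : ℕ} {V : Set E} (hV : IsOpen V) {η g : E → ℝ} (hη : ContDiff ℝ k η)
    (hηV : tsupport η ⊆ V) (hg : ContDiffOn ℝ k g V) : ContDiff ℝ k (fun x => η x * g x) := by
  refine contDiff_iff_contDiffAt.2 fun x => ?_
  by_cases hx : x ∈ tsupport fun x => η x * g x
  · have hxV := hηV (tsupport_mul_subset_left hx)
    exact hη.contDiffAt.mul (hg.contDiffAt (hV.mem_nhds hxV))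
  · exact contDiffAt_const.congr_of_eventuallyEq (notMem_tsupport_iff_eventuallyEq.1 hx)

theorem norm_iteratedFDeriv_mul_le_of_tsupport_subset {E : Type*} [NormedAddCommGroup E]
    [NormedSpace ℝ E] {k : ℕ} {V : Set E} (hV : IsOpen V) {η g : E → ℝ} (hη : ContDiff ℝ k η)
    (hηV : tsupport η ⊆ V) (hg : ContDiffOn ℝ k g V) {x : E} {B M : ℝ} (hB0 : 0 ≤ B) (hM0 : 0 ≤ M)
    (hB : ∀ j ≤ k, ‖iteratedFDeriv ℝ j η x‖ ≤ B)
    (hM : x ∈ V → ∀ j ≤ k, ‖iteratedFDeriv ℝ j g x‖ ≤ M) {i : ℕ} (hi : i ≤ k) :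
    ‖iteratedFDeriv ℝ i (fun x => η x * g x) x‖ ≤ 2 ^ k * B * M := by
  by_cases hx : x ∈ tsupport η
  · have hxV := hηV hx
    have h1 := norm_iteratedFDerivWithin_mul_le hη.contDiffOn hg hV.uniqueDiffOn hxV
      (n := i) (mod_cast hi)
    simp only [iteratedFDerivWithin_of_isOpen _ hV hxV] at h1
    calc _ ≤ ∑ j ∈ Finset.range (i + 1), (i.choose j : ℝ) * B * M := by
          refine h1.trans (Finset.sum_le_sum fun j hj => ?_)
          have := Finset.mem_range.1 hj
          gcongr
          · exact hB j (by omega)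
          · exact hM hxV _ (by omega)
      _ = 2 ^ i * B * M := by
          rw [← Finset.sum_mul, ← Finset.sum_mul]
          norm_cast
          rw [Nat.sum_range_choose]
      _ ≤ _ := by gcongr; norm_num
  · have : iteratedFDeriv ℝ i (fun x => η x * g x) x = 0 := by
      by_contra hne
      exact hx (tsupport_mul_subset_left (support_iteratedFDeriv_subset i hne))
    rw [this, norm_zero]
    positivity

open scoped Manifold ContDiff in
/-- Functions of class `C^t` vanishing on the boundary are approximated, with the optimal rate, by
functions of class `C^k` vanishing on the boundary. -/
theorem exists_global_approx {E : Type} [NormedAddCommGroup E] [NormedSpace ℝ E]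
    [FiniteDimensional ℝ E] [MeasurableSpace E] [BorelSpace E] {Ω : Set E} {t : ℝ} {k : ℕ}
    (hΩ : IsOpen Ω) (hb : Bornology.IsBounded Ω)
    (h : HasSmoothBoundary Ω) (ht : 0 < t) (htk : t ≤ k) :
    ∃ C, 0 ≤ C ∧ ∀ (f : E → ℝ) (N : ℝ), HasCtBound t (closure Ω) f N →
      (∀ x ∈ frontier Ω, f x = 0) → ∀ ε ∈ Ioc (0 : ℝ) 1,
        ∃ g : E → ℝ, ContDiff ℝ k g ∧ (∀ x ∈ frontier Ω, g x = 0) ∧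
          ∀ x ∈ closure Ω, |g x - f x| ≤ C * ε ^ t * N ∧
            ∀ i ≤ k, ‖iteratedFDeriv ℝ i g x‖ ≤ C * ε ^ (t - k) * N := by
  have hK : IsCompact (closure Ω) := hb.isCompact_closure
  choose V hV hxV C hC happ using fun x : closure Ω => exists_local_approx hΩ hb h ht htk x.2
  obtain ⟨T, hT⟩ := hK.elim_finite_subcover V hV
    fun x hx => mem_iUnion.2 ⟨⟨x, hx⟩, hxV ⟨x, hx⟩⟩
  obtain ⟨η, hηV⟩ := SmoothPartitionOfUnity.exists_isSubordinate 𝓘(ℝ, E) hK.isClosed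
    (fun i : T => V i) (fun i => hV i) (hT.trans (by simp [iUnion_subtype]))
  have hηs : ∀ i, ContDiff ℝ (⊤ : ℕ∞) (η i) := fun i => (η i).contMDiff.contDiff
  have hηk : ∀ i, ContDiff ℝ k (η i) := fun i => (hηs i).of_le (mod_cast le_top)
  have hηb : ∀ (i : T) (j : ℕ), ∃ B, ∀ x ∈ closure Ω, ‖iteratedFDeriv ℝ j (η i) x‖ ≤ B :=
    fun i j => hK.exists_bound_of_continuousOn
      ((hηs i).continuous_iteratedFDeriv (mod_cast le_top)).continuousOn
  choose b hbb using hηb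
  set B : ℝ := ∑ i, ∑ j ∈ Finset.range (k + 1), |b i j| with hB
  have hB0 : 0 ≤ B := Finset.sum_nonneg fun _ _ => Finset.sum_nonneg fun _ _ => abs_nonneg _
  have hBle : ∀ x ∈ closure Ω, ∀ i, ∀ j ≤ k, ‖iteratedFDeriv ℝ j (η i) x‖ ≤ B := by
    intro x hx i j hj
    calc _ ≤ |b i j| := (hbb i j x hx).trans (le_abs_self _)
      _ ≤ ∑ j ∈ Finset.range (k + 1), |b i j| :=
          Finset.single_le_sum (f := fun j => |b i j|) (fun _ _ => abs_nonneg _)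
            (Finset.mem_range.2 (by omega))
      _ ≤ B := Finset.single_le_sum (f := fun i => ∑ j ∈ Finset.range (k + 1), |b i j|)
            (fun _ _ => Finset.sum_nonneg fun _ _ => abs_nonneg _) (Finset.mem_univ i)
  set A : ℝ := ∑ i : T, C i with hA
  have hA0 : 0 ≤ A := Finset.sum_nonneg fun i _ => hC i
  have hCA : ∀ i : T, C i ≤ A := fun i =>
    Finset.single_le_sum (f := fun i : T => C i) (fun i _ => hC i) (Finset.mem_univ i)
  refine ⟨A * (1 + Fintype.card T * (2 ^ k * B)), by positivity, fun f N hf hf0 ε hε => ?_⟩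
  have hε0 := hε.1
  have hN := hf.nonneg
  choose g hg hg0 hgx using fun i : T => happ i f N hf hf0 ε hε
  have hprod : ∀ i : T, ContDiff ℝ k (fun x => η i x * g i x) := fun i =>
    contDiff_mul_of_tsupport_subset (hV i) (hηk i) (hηV i) (hg i)
  have hzero : ∀ (i : T) x, x ∉ V i → η i x = 0 := fun i x hx =>
    image_eq_zero_of_notMem_tsupport fun hx' => hx (hηV i hx')
  have hfac : (1 : ℝ) ≤ 1 + Fintype.card T * (2 ^ k * B) :=
    le_add_of_nonneg_right (by positivity)
  refine ⟨fun x => ∑ i, η i x * g i x, ContDiff.sum fun i _ => hprod i, fun x hx => ?_,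
    fun x hx => ⟨?_, fun j hj => ?_⟩⟩
  · refine Finset.sum_eq_zero fun i _ => ?_
    by_cases hxi : x ∈ V i
    · rw [hg0 i x ⟨hxi, hx⟩, mul_zero]
    · rw [hzero i x hxi, zero_mul]
  · have hsum : ∑ i, η i x = 1 := by
      rw [← finsum_eq_sum_of_fintype]; exact η.sum_eq_one hx
    calc |∑ i, η i x * g i x - f x| = |∑ i, η i x * (g i x - f x)| := by
          simp only [mul_sub, Finset.sum_sub_distrib, ← Finset.sum_mul, hsum, one_mul]
      _ ≤ ∑ i, |η i x * (g i x - f x)| := Finset.abs_sum_le_sum_abs _ _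
      _ ≤ ∑ i, η i x * (A * ε ^ t * N) := by
          refine Finset.sum_le_sum fun i _ => ?_
          rw [abs_mul, abs_of_nonneg (η.nonneg i x)]
          by_cases hxi : x ∈ V i
          · refine mul_le_mul_of_nonneg_left ((hgx i x ⟨hxi, hx⟩).1.trans ?_) (η.nonneg i x)
            have := hCA i
            gcongr
          · simp [hzero i x hxi]
      _ = A * 1 * ε ^ t * N := by rw [← Finset.sum_mul, hsum]; ring
      _ ≤ _ := by gcongr
  · rw [iteratedFDeriv_fun_sum_apply fun i _ => ((hprod i).of_le (mod_cast hj)).contDiffAt]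
    calc _ ≤ ∑ _i : T, 2 ^ k * B * (A * ε ^ (t - k) * N) := by
          refine norm_sum_le_of_le _ fun i _ => ?_
          refine norm_iteratedFDeriv_mul_le_of_tsupport_subset (hV i) (hηk i) (hηV i) (hg i) hB0
            (by positivity) (hBle x hx i) (fun hxi l hl => ((hgx i x ⟨hxi, hx⟩).2 l hl).trans ?_) hj
          have := hCA i
          gcongr
      _ = A * (Fintype.card T * (2 ^ k * B)) * ε ^ (t - k) * N := by
          rw [Finset.sum_const, nsmul_eq_mul, Finset.card_univ]; ring
      _ ≤ _ := by gcongr; norm_num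

end Global

section Norms

variable {E : Type*} [NormedAddCommGroup E] [NormedSpace ℝ E] {t : ℝ} {S : Set E} {f : E → ℝ}

theorem ctNorm_nonneg : 0 ≤ ctNorm t S f :=
  le_max_of_le_left (Real.sSup_nonneg (by rintro _ ⟨i, -, x, -, rfl⟩; exact norm_nonneg _))

theorem MemCt.hasCtBound (ht : 0 ≤ t) (hf : MemCt t S f) : HasCtBound t S f (ctNorm t S f) := by
  obtain ⟨h1, ⟨C₁, hC₁⟩, C₂, hC₂⟩ := hf
  refine ⟨ctNorm_nonneg, h1, fun j hj x hx => ?_, fun x hx y hy => ?_⟩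
  · have hjt : (j : ℝ) ≤ t := (Nat.le_floor_iff ht).1 hj
    refine le_max_of_le_left (le_csSup ⟨C₁, ?_⟩ ⟨j, hjt, x, hx, rfl⟩)
    rintro _ ⟨i, hi, x, hx, rfl⟩
    exact hC₁ i hi x hx
  · by_cases hxy : x = y
    · rw [hxy, sub_self, norm_zero]
      exact mul_nonneg ctNorm_nonneg (Real.rpow_nonneg (norm_nonneg _) _)
    have hpos : ∀ x y : E, x ≠ y → 0 < ‖x - y‖ ^ (t - (⌊t⌋₊ : ℝ)) := fun x y hxy =>
      Real.rpow_pos_of_pos (norm_pos_iff.2 (sub_ne_zero.2 hxy)) _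
    rw [← div_le_iff₀ (hpos x y hxy)]
    refine le_max_of_le_right (le_csSup ⟨C₂, ?_⟩ ⟨x, hx, y, hy, hxy, rfl⟩)
    rintro _ ⟨x, hx, y, hy, hxy, rfl⟩
    rw [div_le_iff₀ (hpos x y hxy)]
    exact hC₂ x hx y hy

variable {n : ℕ} {M : ℝ}

/-- At integer order, the `C^n` norm is at most twice the bound on the derivatives. -/
theorem memCt_natCast_and_ctNorm_le (hf : ContDiffOn ℝ n f S) (hM : 0 ≤ M)
    (h : ∀ i ≤ n, ∀ x ∈ S, ‖iteratedFDerivWithin ℝ i f S x‖ ≤ M) :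
    MemCt n S f ∧ ctNorm n S f ≤ 2 * M := by
  have hdiff : ∀ x ∈ S, ∀ y ∈ S,
      ‖iteratedFDerivWithin ℝ ⌊(n : ℝ)⌋₊ f S x - iteratedFDerivWithin ℝ ⌊(n : ℝ)⌋₊ f S y‖
        ≤ 2 * M :=
    fun x hx y hy => (norm_sub_le _ _).trans (by
      have := h _ (Nat.floor_natCast (R := ℝ) n).le x hx
      have := h _ (Nat.floor_natCast (R := ℝ) n).le y hy
      linarith)
  refine ⟨⟨by rwa [Nat.floor_natCast], ⟨M, fun i hi => h i (mod_cast hi)⟩, 2 * M, ?_⟩, ?_⟩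
  · simpa only [Nat.floor_natCast, sub_self, Real.rpow_zero, mul_one] using hdiff
  · refine max_le (Real.sSup_le ?_ (by positivity)) (Real.sSup_le ?_ (by positivity))
    · rintro _ ⟨i, hi, x, hx, rfl⟩
      have := h i (mod_cast hi) x hx
      linarith
    · rintro _ ⟨x, hx, y, hy, -, rfl⟩
      simpa only [Nat.floor_natCast, sub_self, Real.rpow_zero, div_one] using hdiff x hx y hy

theorem memCt_zero_and_ctNorm_le (hf : ContinuousOn f S) (hM : 0 ≤ M)
    (h : ∀ x ∈ S, |f x| ≤ M) : MemCt 0 S f ∧ ctNorm 0 S f ≤ 2 * M := by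
  have := memCt_natCast_and_ctNorm_le (n := 0) (by simpa using hf) hM fun i hi x hx => by
    obtain rfl : i = 0 := by omega
    simpa using h x hx
  simpa using this

theorem kFunctional_le {s t₀ t₁ : ℝ} (hs : 0 ≤ s) {Ω : Set E} {f₀ f₁ : E → ℝ}
    (hsum : ∀ x ∈ closure Ω, f x = f₀ x + f₁ x) (h₀ : MemCtTilde t₀ Ω f₀)
    (h₁ : MemCtTilde t₁ Ω f₁) :
    kFunctional s t₀ t₁ Ω f ≤ ctNorm t₀ (closure Ω) f₀ + s * ctNorm t₁ (closure Ω) f₁ := by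
  refine csInf_le ⟨0, ?_⟩ ⟨f₀, f₁, hsum, h₀, h₁, rfl⟩
  rintro _ ⟨g₀, g₁, -, -, -, rfl⟩
  exact add_nonneg ctNorm_nonneg (mul_nonneg hs ctNorm_nonneg)

end Norms

/-- For a bounded open `Ω ⊆ ℝ^m` with smooth boundary, an integer `k ≥ 1` and
`α ∈ (0,1)`, the inclusion `C̃^{αk}(cl Ω) ⊆ (C̃^0(cl Ω), C̃^k(cl Ω))_{α,∞}` is continuous:
`sup_{s>0} s^{-α} K(s, f; C̃^0, C̃^k) ≤ C ‖f‖_{C^{αk}(cl Ω)}`. -/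
theorem interpolation_inclusion_of_holder (m : ℕ) (Ω : Set (EuclideanSpace ℝ (Fin m)))
    (hΩopen : IsOpen Ω) (hΩbdd : Bornology.IsBounded Ω) (hΩsmooth : HasSmoothBoundary Ω)
    (k : ℕ) (hk : 1 ≤ k) (α : ℝ) (hα : α ∈ Ioo (0:ℝ) 1) :
    ∃ C > 0, ∀ f : EuclideanSpace ℝ (Fin m) → ℝ, MemCtTilde (α * k) Ω f →
      ∀ s : ℝ, 0 < s →
        s ^ (-α) * kFunctional s 0 (k : ℝ) Ω f ≤ C * ctNorm (α * k) (closure Ω) f := by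
  have hk0 : (0 : ℝ) < k := mod_cast hk
  have ht : 0 < α * k := mul_pos hα.1 hk0
  have htk : α * k ≤ k := mul_le_of_le_one_left hk0.le hα.2.le
  obtain ⟨C, hC, happ⟩ := exists_global_approx hΩopen hΩbdd hΩsmooth ht htk
  have huniq := hΩsmooth.uniqueDiffOn_closure hΩopen
  refine ⟨4 * C + 2, by positivity, fun f hf s hs => ?_⟩
  have hfN := hf.1.hasCtBound ht.le
  set N := ctNorm (α * k) (closure Ω) f with hN
  have hN0 : 0 ≤ N := ctNorm_nonneg
  rcases le_or_gt s 1 with hs1 | hs1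
  · set ε := s ^ (k : ℝ)⁻¹ with hε
    have hε0 : 0 < ε := Real.rpow_pos_of_pos hs _
    obtain ⟨g, hg, hg0, hgx⟩ := happ f N hfN hf.2 ε
      ⟨hε0, Real.rpow_le_one hs.le hs1 (by positivity)⟩
    have hεt : ε ^ (α * k) = s ^ α := by
      rw [hε, ← Real.rpow_mul hs.le]; congr 1; field_simp
    have hεtk : ε ^ (α * k - k) = s ^ (α - 1) := by
      rw [hε, ← Real.rpow_mul hs.le]; congr 1; field_simp
    rw [hεt, hεtk] at hgx
    obtain ⟨m0, b0⟩ := memCt_zero_and_ctNorm_le (M := C * s ^ α * N) (S := closure Ω)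
      (f := fun x => f x - g x) (hfN.contDiffOn.continuousOn.sub hg.continuous.continuousOn)
      (by positivity) fun x hx => by rw [abs_sub_comm]; exact (hgx x hx).1
    obtain ⟨m1, b1⟩ := memCt_natCast_and_ctNorm_le (M := C * s ^ (α - 1) * N) (S := closure Ω)
      hg.contDiffOn (by positivity) fun i hi x hx => by
        rw [iteratedFDerivWithin_eq_iteratedFDeriv huniq
          (hg.of_le (mod_cast hi)).contDiffAt hx]
        exact (hgx x hx).2 i hi
    have hK := kFunctional_le hs.le (f := f) (f₀ := fun x => f x - g x) (f₁ := g)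
      (fun x _ => by ring) ⟨m0, fun x hx => by simp [hf.2 x hx, hg0 x hx]⟩ ⟨m1, hg0⟩
    have hs_mul : s * s ^ (α - 1) = s ^ α := by
      rw [Real.rpow_sub_one hs.ne']; field_simp
    have hs_neg : s ^ (-α) * s ^ α = 1 := by
      rw [← Real.rpow_add hs, neg_add_cancel, Real.rpow_zero]
    calc _ ≤ s ^ (-α) * (2 * (C * s ^ α * N) + s * (2 * (C * s ^ (α - 1) * N))) := by
          gcongr
          exact hK.trans (by gcongr)
      _ = 2 * C * N * (s ^ (-α) * s ^ α) + 2 * C * N * (s ^ (-α) * (s * s ^ (α - 1))) := by ring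
      _ = 4 * C * N := by rw [hs_mul, hs_neg]; ring
      _ ≤ _ := by gcongr; norm_num
  · obtain ⟨m0, b0⟩ := memCt_zero_and_ctNorm_le (M := N) (S := closure Ω) (f := f)
      hfN.contDiffOn.continuousOn hN0 fun x hx => by
        simpa using hfN.norm_le 0 (Nat.zero_le _) x hx
    obtain ⟨m1, b1⟩ := memCt_natCast_and_ctNorm_le (n := k) (M := 0) (S := closure Ω)
      (f := fun _ : EuclideanSpace ℝ (Fin m) => (0 : ℝ)) contDiffOn_const le_rfl
      fun i _ x _ => by simp
    have hK := kFunctional_le hs.le (f := f) (f₀ := f) (f₁ := fun _ => 0)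
      (fun x _ => by ring) ⟨m0, hf.2⟩ ⟨m1, fun _ _ => rfl⟩
    calc _ ≤ s ^ (-α) * (2 * N + s * (2 * 0)) := by
          gcongr
          exact hK.trans (by gcongr)
      _ = s ^ (-α) * (2 * N) := by ring
      _ ≤ 1 * (2 * N) := by
          gcongr
          exact Real.rpow_le_one_of_one_le_of_nonpos hs1.le (by linarith [hα.1])
      _ ≤ _ := by rw [one_mul]; gcongr; linarith

end
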